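/- arXiv:2409.17147 — 13 statements merged into one kernel-verified Lean document; each statement's English description precedes it below -/
import Mathlib

section
/- Let F_q be a finite field, let f ∈ F_q[x] have positive degree with f(0) ≠ 0, let ρ = qord(f), and let a ∈ F_q^* be the element with f dividing x^ρ - a. Then for every positive integer e and every d ∈ F_q^*, f divides x^e - d if and only if ρ divides e and d = a^{e/ρ}. -/
open Polynomial

/-- The quasi-order of a polynomial `f`: the least positive integer `ρ` such that
`f` divides `X ^ ρ - C a` for some nonzero element `a`. -/
noncomputable def qord {F : Type*} [Field F] (f : F[X]) : ℕ :=
  sInf {ρ : ℕ | 0 < ρ ∧ ∃ a : F, a ≠ 0 ∧ f ∣ (X ^ ρ - C a)}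

theorem stmt_0 {F : Type*} [Field F] [Fintype F] (f : F[X])
    (hdeg : 0 < f.natDegree) (h0 : f.eval 0 ≠ 0)
    (a : F) (ha : a ≠ 0) (hfa : f ∣ X ^ qord f - C a)
    (e : ℕ) (he : 0 < e) (d : F) (hd : d ≠ 0) :
    f ∣ X ^ e - C d ↔ qord f ∣ e ∧ d = a ^ (e / qord f) := by
  have hpow : ∀ k : ℕ, f ∣ X ^ (qord f * k) - C (a ^ k) := by
    intro k
    rw [pow_mul, C_pow]
    exact hfa.trans (sub_dvd_pow_sub_pow _ _ k)
  constructor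
  · intro h
    have hmem : qord f ∈ {ρ : ℕ | 0 < ρ ∧ ∃ a : F, a ≠ 0 ∧ f ∣ (X ^ ρ - C a)} :=
      Nat.sInf_mem ⟨e, he, d, hd, h⟩
    have hpos : 0 < qord f := hmem.1
    have hak : a ^ (e / qord f) ≠ 0 := pow_ne_zero _ ha
    have hkey : f ∣ C (a ^ (e / qord f)) * X ^ (e % qord f) - C d := by
      have h1 := dvd_sub h ((hpow (e / qord f)).mul_left (X ^ (e % qord f)))
      have h2 : (X : F[X]) ^ e = X ^ (e % qord f) * X ^ (qord f * (e / qord f)) := by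
        rw [← pow_add, Nat.mod_add_div]
      rw [h2] at h1
      convert h1 using 1
      ring
    have hr : e % qord f = 0 := by
      by_contra hne
      have hle : qord f ≤ e % qord f := by
        refine Nat.sInf_le ⟨Nat.pos_of_ne_zero hne, (a ^ (e / qord f))⁻¹ * d,
          mul_ne_zero (inv_ne_zero hak) hd, ?_⟩
        have h3 := hkey.mul_left (C (a ^ (e / qord f))⁻¹)
        rwa [mul_sub, ← mul_assoc, ← C_mul, ← C_mul, inv_mul_cancel₀ hak, C_1, one_mul] at h3
      exact absurd (Nat.mod_lt e hpos) (not_lt.mpr hle)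
    refine ⟨Nat.dvd_of_mod_eq_zero hr, ?_⟩
    rw [hr, pow_zero, mul_one, ← C_sub] at hkey
    by_contra hne
    have hnz : C (a ^ (e / qord f) - d) ≠ 0 :=
      C_ne_zero.mpr (sub_ne_zero.mpr (Ne.symm hne))
    have := natDegree_le_of_dvd hkey hnz
    rw [natDegree_C] at this
    omega
  · rintro ⟨hdvd, hd'⟩
    have h := hpow (e / qord f)
    rwa [Nat.mul_div_cancel' hdvd, ← hd'] at h
end

section
/- Let F_q be a finite field, let f ∈ F_q[x] be monic of degree two with f(0) ≠ 0, let ρ = qord(f), and let a ∈ F_q^* be such that f divides x^ρ - a. Let g = (x^{ρ+1} - a·x)/f be the exact quotient in F_q[x]. Then g has degree ρ - 1, the constant coefficient of g is 0, and for every degree d with 1 ≤ d ≤ ρ - 1 the coefficient of x^d in g is nonzero. -/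
open Polynomial

theorem aux_dvd {F : Type*} [Field F] (b c a : F) (r m : ℕ) (hm : m + 1 < r) (h : F[X])
    (hh : (X ^ 2 + C b * X + C c) * h = X ^ r - C a) (h0 : h.coeff m = 0) :
    ∃ e : F, (X ^ 2 + C b * X + C c) ∣ C e * X ^ (m + 1) - C a := by
  set low : F[X] := ∑ i ∈ Finset.range m, monomial i (h.coeff i) with hlow
  have lc : ∀ n, low.coeff n = if n < m then h.coeff n else 0 := by
    intro n
    simp [hlow, finset_sum_coeff, coeff_monomial]
  have fc : ∀ (p : F[X]) (n : ℕ), ((X ^ 2 + C b * X + C c) * p).coeff (n + 2)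
      = p.coeff n + b * p.coeff (n + 1) + c * p.coeff (n + 2) := by
    intro p n
    simp only [add_mul, coeff_add, mul_assoc, coeff_C_mul, coeff_X_pow_mul, coeff_X_mul]
  have fc1 : ∀ (p : F[X]), ((X ^ 2 + C b * X + C c) * p).coeff 1
      = b * p.coeff 0 + c * p.coeff 1 := by
    intro p
    have : (X ^ 2 * p).coeff 1 = 0 := by
      rw [coeff_X_pow_mul']; simp
    have h2 : (X * p).coeff 1 = p.coeff 0 := coeff_X_mul p 0
    simp only [add_mul, coeff_add, mul_assoc, coeff_C_mul, this, h2, zero_add]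
  have fc0 : ∀ (p : F[X]), ((X ^ 2 + C b * X + C c) * p).coeff 0 = c * p.coeff 0 := by
    intro p
    simp [mul_coeff_zero]
  have key : ∀ n, n ≤ m → low.coeff n = h.coeff n := by
    intro n hn
    rw [lc]
    split_ifs with h1
    · rfl
    · rw [show n = m by omega, h0]
  have key2 : ∀ n, m ≤ n → low.coeff n = 0 := by
    intro n hn
    rw [lc, if_neg (by omega)]
  refine ⟨((X ^ 2 + C b * X + C c) * low).coeff (m + 1), low, ?_⟩
  symm
  ext n
  rcases lt_trichotomy n (m + 1) with hn | hn | hn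
  · have e1 : ((X ^ 2 + C b * X + C c) * low).coeff n
        = ((X ^ 2 + C b * X + C c) * h).coeff n := by
      match n, hn with
      | 0, hn => rw [fc0, fc0, key _ (by omega)]
      | 1, hn => rw [fc1, fc1, key _ (by omega), key _ (by omega)]
      | n + 2, hn => rw [fc, fc, key _ (by omega), key _ (by omega), key _ (by omega)]
    rw [e1, hh, coeff_sub, coeff_sub, coeff_C_mul, coeff_X_pow, coeff_X_pow,
      if_neg (by omega), if_neg (by omega), mul_zero]
  · subst hn
    rw [coeff_sub, coeff_C_mul, coeff_X_pow, if_pos rfl, coeff_C, if_neg (by omega)]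
    ring
  · obtain ⟨k, rfl⟩ : ∃ k, n = k + 2 := ⟨n - 2, by omega⟩
    rw [fc, key2 _ (by omega), key2 _ (by omega), key2 _ (by omega), coeff_sub, coeff_C_mul,
      coeff_X_pow, if_neg (by omega), coeff_C, if_neg (by omega)]
    ring

theorem stmt_1 {F : Type*} [Field F] [Fintype F] (f : F[X])
    (hmonic : f.Monic) (hdeg : f.natDegree = 2) (h0 : f.eval 0 ≠ 0)
    (a : F) (ha : a ≠ 0) (hfa : f ∣ X ^ qord f - C a)
    (g : F[X]) (hg : X ^ (qord f + 1) - C a * X = f * g) :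
    g.natDegree = qord f - 1 ∧ g.coeff 0 = 0 ∧
      ∀ d : ℕ, 1 ≤ d → d ≤ qord f - 1 → g.coeff d ≠ 0 := by
  have hf0 : f ≠ 0 := hmonic.ne_zero
  have noconst : ∀ y : F, f ∣ C y → y = 0 := by
    intro y hy
    by_contra hne
    have := natDegree_le_of_dvd hy (C_ne_zero.mpr hne)
    rw [hdeg, natDegree_C] at this
    omega
  obtain ⟨h, hh⟩ := hfa
  have hgh : g = X * h := by
    apply mul_left_cancel₀ hf0
    rw [← hg, mul_left_comm, ← hh]
    ring
  have hmin : ∀ k, 0 < k → k < qord f → ∀ y : F, y ≠ 0 → ¬ f ∣ X ^ k - C y := by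
    intro k hk hlt y hy hd
    exact Nat.notMem_of_lt_sInf hlt ⟨hk, y, hy, hd⟩
  generalize qord f = r at *
  rcases Nat.eq_zero_or_pos r with rfl | hr
  · have : (1 - a) = 0 := noconst _ ⟨h, by rw [← hh]; simp⟩
    have ha1 : a = 1 := (sub_eq_zero.mp this).symm
    subst ha1
    have : h = 0 := by
      have : f * h = 0 := by rw [← hh]; simp
      exact (mul_eq_zero.mp this).resolve_left hf0
    subst this
    simp only [mul_zero] at hgh
    subst hgh
    refine ⟨by simp, by simp, ?_⟩
    intro d h1 h2
    omega
  · have hne : (X ^ r - C a : F[X]) ≠ 0 := X_pow_sub_C_ne_zero hr a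
    have hhne : h ≠ 0 := by
      rintro rfl
      exact hne (by rw [hh, mul_zero])
    have hdg : r = 2 + h.natDegree := by
      rw [← hdeg, ← natDegree_mul hf0 hhne, ← hh, natDegree_X_pow_sub_C]
    refine ⟨?_, ?_, ?_⟩
    · rw [hgh, natDegree_X_mul hhne]; omega
    · rw [hgh]; simp
    · intro d h1 h2 hd
      obtain ⟨m, rfl⟩ : ∃ m, d = m + 1 := ⟨d - 1, by omega⟩
      rw [hgh, coeff_X_mul] at hd
      have hf : f = X ^ 2 + C (f.coeff 1) * X + C (f.coeff 0) := by
        have h2 : f.coeff 2 = 1 := by rw [← hdeg]; exact hmonic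
        conv_lhs => rw [f.as_sum_range_C_mul_X_pow, hdeg]
        simp [Finset.sum_range_succ, h2]
        ring
      obtain ⟨e, he⟩ := aux_dvd (f.coeff 1) (f.coeff 0) a r m (by omega) h
        (by rw [← hf, hh]) hd
      rw [← hf] at he
      by_cases he0 : e = 0
      · subst he0
        apply ha
        apply noconst
        rw [← dvd_neg]
        simpa using he
      · refine hmin (m + 1) (by omega) (by omega) (e⁻¹ * a)
          (mul_ne_zero (inv_ne_zero he0) ha) ?_
        have := he.mul_left (C e⁻¹)
        rwa [mul_sub, ← mul_assoc, ← C_mul, ← C_mul, inv_mul_cancel₀ he0, C_1, one_mul] at this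
end

section
/- Let F_q be a finite field, let f ∈ F_q[x] be monic of degree two with f(0) ≠ 0, let ρ = qord(f), and let e ≥ 2 be an integer. Let h, r ∈ F_q[x] be the unique polynomials with x^e = f·h + r and deg(r) < 2 (i.e., h is the quotient and r the remainder of dividing x^e by f). Then e ≤ ρ if and only if h has degree e - 2 and all of its coefficients in degrees 0, 1, ..., e-2 are nonzero. -/
open Polynomial

/-- coefficients of the remainder of `X ^ n` modulo `X ^ 2 + a X + b` -/
def remSeq {F : Type*} [Field F] (a b : F) : ℕ → F × F
  | 0 => (0, 1)
  | n + 1 => ((remSeq a b n).2 - a * (remSeq a b n).1, - b * (remSeq a b n).1)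

/-- the quotient of `X ^ n` by `X ^ 2 + a X + b` -/
noncomputable def quoSeq {F : Type*} [Field F] (a b : F) : ℕ → F[X]
  | 0 => 0
  | n + 1 => X * quoSeq a b n + C (remSeq a b n).1

lemma quo_rem {F : Type*} [Field F] (a b : F) (n : ℕ) :
    (X : F[X]) ^ n = (X ^ 2 + C a * X + C b) * quoSeq a b n
      + (C (remSeq a b n).1 * X + C (remSeq a b n).2) := by
  induction n with
  | zero => simp [quoSeq, remSeq]
  | succ n ih =>
    rw [pow_succ, ih]
    simp only [quoSeq, remSeq, map_sub, map_mul, map_neg]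
    ring

lemma quo_coeff {F : Type*} [Field F] (a b : F) (n d : ℕ) :
    (quoSeq a b n).coeff d = if d < n then (remSeq a b (n - 1 - d)).1 else 0 := by
  induction n generalizing d with
  | zero => simp [quoSeq]
  | succ n ih =>
    cases d with
    | zero => simp [quoSeq]
    | succ d =>
      simp only [quoSeq, coeff_add, coeff_X_mul, ih, coeff_C_succ, add_zero]
      simp only [Nat.add_lt_add_iff_right]
      congr 3
      omega

theorem stmt_2 {F : Type*} [Field F] [Fintype F] (f : F[X])
    (hmonic : f.Monic) (hdeg : f.natDegree = 2) (h0 : f.eval 0 ≠ 0)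
    (e : ℕ) (he : 2 ≤ e)
    (h r : F[X]) (hdiv : (X : F[X]) ^ e = f * h + r) (hr : r.degree < 2) :
    e ≤ qord f ↔ h.natDegree = e - 2 ∧ ∀ d : ℕ, d ≤ e - 2 → h.coeff d ≠ 0 := by
  classical
  obtain ⟨a, b, hf⟩ : ∃ a b : F, f = X ^ 2 + C a * X + C b := by
    refine ⟨f.coeff 1, f.coeff 0, ?_⟩
    conv_lhs => rw [f.as_sum_range_C_mul_X_pow, hdeg]
    have : f.coeff 2 = 1 := by rw [← hdeg]; exact hmonic
    simp [Finset.sum_range_succ, this]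
    ring
  have hfd : f.degree = 2 := by
    rw [degree_eq_natDegree hmonic.ne_zero, hdeg]; rfl
  have key : ∀ n, (X : F[X]) ^ n = f * quoSeq a b n
      + (C (remSeq a b n).1 * X + C (remSeq a b n).2) := by
    intro n; rw [hf]; exact quo_rem a b n
  have lin : ∀ s t : F, (C s * X + C t).degree < 2 := fun s t =>
    lt_of_le_of_lt degree_linear_le (by norm_num)
  have hh : h = quoSeq a b e := by
    have h1 := (div_modByMonic_unique (f := X ^ e) h r hmonic ⟨by rw [hdiv]; ring, by rw [hfd]; exact hr⟩).1
    have h2 := (div_modByMonic_unique (f := X ^ e) (quoSeq a b e)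
      (C (remSeq a b e).1 * X + C (remSeq a b e).2) hmonic
      ⟨by rw [key e]; ring, by rw [hfd]; exact lin (remSeq a b e).1 (remSeq a b e).2⟩).1
    rw [← h1, ← h2]
  have hcop : ∀ n, IsCoprime f ((X : F[X]) ^ n) := by
    intro n
    apply IsCoprime.pow_right
    refine (((irreducible_X (R := F)).coprime_iff_not_dvd).2 ?_).symm
    rw [X_dvd_iff, coeff_zero_eq_eval_zero]
    exact h0
  have hnu : ¬ IsUnit f := by
    intro hu
    have := natDegree_eq_zero_of_isUnit hu
    omega
  have hdvd : ∀ n, (∃ c : F, c ≠ 0 ∧ f ∣ (X ^ n - C c)) ↔ (remSeq a b n).1 = 0 := by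
    intro n
    constructor
    · rintro ⟨c, -, hc⟩
      have h1 : f ∣ C (remSeq a b n).1 * X + C ((remSeq a b n).2 - c) := by
        have := dvd_sub hc (dvd_mul_right f (quoSeq a b n))
        rw [key n] at this
        convert this using 1
        rw [map_sub]; ring
      have h2 := eq_zero_of_dvd_of_degree_lt h1 (by rw [hfd]; exact lin _ _)
      have h3 := congrArg (fun p => coeff p 1) h2
      simpa [coeff_C] using h3
    · intro hs
      have h1 := key n
      rw [hs] at h1
      refine ⟨(remSeq a b n).2, ?_, ⟨quoSeq a b n, by rw [h1]; simp⟩⟩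
      intro ht
      rw [ht] at h1
      apply hnu
      apply (hcop n).isUnit_of_dvd' dvd_rfl
      exact ⟨quoSeq a b n, by rw [h1]; simp⟩
  have hne : {ρ : ℕ | 0 < ρ ∧ ∃ a : F, a ≠ 0 ∧ f ∣ (X ^ ρ - C a)}.Nonempty := by
    obtain ⟨i, j, hij, hEq⟩ : ∃ i j : ℕ, i < j ∧ remSeq a b i = remSeq a b j := by
      obtain ⟨i, j, hij, hEq⟩ := Finite.exists_ne_map_eq_of_infinite (remSeq a b)
      rcases lt_or_gt_of_ne hij with h | h
      · exact ⟨i, j, h, hEq⟩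
      · exact ⟨j, i, h, hEq.symm⟩
    refine ⟨j - i, by omega, 1, one_ne_zero, ?_⟩
    apply (hcop i).dvd_of_dvd_mul_left
    have h1 : (X : F[X]) ^ i * (X ^ (j - i) - C 1) = X ^ j - X ^ i := by
      rw [mul_sub, ← pow_add, Nat.add_sub_cancel' hij.le]; simp
    rw [h1, key i, key j, hEq]
    exact ⟨quoSeq a b j - quoSeq a b i, by ring⟩
  have hL : e ≤ qord f ↔ ∀ k, 0 < k → k < e → (remSeq a b k).1 ≠ 0 := by
    unfold qord
    constructor
    · intro hle k hk hke hs
      have := Nat.sInf_le (s := {ρ : ℕ | 0 < ρ ∧ ∃ a : F, a ≠ 0 ∧ f ∣ (X ^ ρ - C a)})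
        (m := k) ⟨hk, (hdvd k).2 hs⟩
      omega
    · intro hall
      by_contra hlt
      have hm := Nat.sInf_mem hne
      exact hall _ hm.1 (not_le.1 hlt) ((hdvd _).1 hm.2)
  rw [hL, hh]
  constructor
  · intro hall
    have hc : ∀ d : ℕ, d ≤ e - 2 → (quoSeq a b e).coeff d ≠ 0 := by
      intro d hd
      rw [quo_coeff, if_pos (by omega)]
      exact hall _ (by omega) (by omega)
    refine ⟨natDegree_eq_of_le_of_coeff_ne_zero ?_ (hc _ le_rfl), hc⟩
    rw [natDegree_le_iff_coeff_eq_zero]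
    intro N hN
    rw [quo_coeff]
    split_ifs with hlt
    · have : e - 1 - N = 0 := by omega
      rw [this]; rfl
    · rfl
  · rintro ⟨-, hc⟩ k hk hke
    have := hc (e - 1 - k) (by omega)
    rw [quo_coeff, if_pos (by omega)] at this
    have h2 : e - 1 - (e - 1 - k) = k := by omega
    rwa [h2] at this
end

section
/- Let F_q be a finite field, let b, c, m ∈ F_q^*, let j be a positive integer, and set f₁ = x² + b·x + c and f₂ = x² + m^j·b·x + m^{2j}·c in F_q[x]. Let e ≥ 2 be an integer and suppose x^e ≡ k·x + l (mod f₁) for elements k, l ∈ F_q. Then x^e ≡ m^{(e-1)j}·k·x + m^{ej}·l (mod f₂). -/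
open Polynomial

theorem stmt_3 {F : Type*} [Field F] [Fintype F] (b c m : F)
    (hb : b ≠ 0) (hc : c ≠ 0) (hm : m ≠ 0) (j : ℕ) (hj : 0 < j)
    (e : ℕ) (he : 2 ≤ e) (k l : F)
    (hcong : (X ^ 2 + C b * X + C c : F[X]) ∣ X ^ e - (C k * X + C l)) :
    (X ^ 2 + C (m ^ j * b) * X + C (m ^ (2 * j) * c) : F[X]) ∣
      X ^ e - (C (m ^ ((e - 1) * j) * k) * X + C (m ^ (e * j) * l)) := by
  obtain ⟨q, hq⟩ := hcong
  obtain ⟨d, rfl⟩ : ∃ d, e = d + 2 := ⟨e - 2, by omega⟩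
  have hn : m ^ j ≠ 0 := pow_ne_zero _ hm
  have e1 : m ^ ((d + 2 - 1) * j) = (m ^ j) ^ (d + 1) := by
    rw [← pow_mul, mul_comm j]; rfl
  have e2 : m ^ ((d + 2) * j) = (m ^ j) ^ (d + 2) := by
    rw [← pow_mul, mul_comm j]
  have e3 : m ^ (2 * j) = (m ^ j) ^ 2 := by
    rw [← pow_mul, mul_comm j]
  rw [e1, e2, e3]
  generalize m ^ j = n at hn
  have h := congrArg (fun p : F[X] => p.comp (C n⁻¹ * X)) hq
  simp only [sub_comp, add_comp, mul_comp, pow_comp, X_comp, C_comp] at h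
  have hX : (X : F[X]) = C n * (C n⁻¹ * X) := by
    rw [← mul_assoc, ← C_mul, mul_inv_cancel₀ hn, C_1, one_mul]
  refine ⟨C n ^ d * q.comp (C n⁻¹ * X), ?_⟩
  generalize q.comp (C n⁻¹ * X) = Q at h ⊢
  simp only [C_mul, C_pow]
  generalize C n⁻¹ * X = Y at h hX
  rw [hX]
  linear_combination (C n) ^ (d + 2) * h
end

section
/- Let F_q be a finite field, let b, c, m ∈ F_q^*, let j be a positive integer, and set f₁ = x² + b·x + c and f₂ = x² + m^j·b·x + m^{2j}·c in F_q[x]. Then qord(f₁) = qord(f₂). -/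
open Polynomial

theorem qord_aux {F : Type*} [Field F] (b c s a : F) (hs : s ≠ 0) (r : ℕ)
    (h : (X ^ 2 + C b * X + C c : F[X]) ∣ X ^ r - C a) :
    (X ^ 2 + C (s * b) * X + C (s ^ 2 * c) : F[X]) ∣ X ^ r - C (s ^ r * a) := by
  obtain ⟨g, hg⟩ := h
  have h2 := congrArg (fun p : F[X] => p.comp (C s⁻¹ * X)) hg
  simp only [sub_comp, mul_comp, add_comp, pow_comp, X_comp, C_comp] at h2
  have hss : (C s * C s⁻¹ : F[X]) = 1 := by
    rw [← C_mul, mul_inv_cancel₀ hs, C_1]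
  have hr : (C s ^ r * C s⁻¹ ^ r : F[X]) = 1 := by
    rw [← mul_pow, hss, one_pow]
  refine ⟨C s ^ r * C s⁻¹ ^ 2 * g.comp (C s⁻¹ * X), ?_⟩
  have e1 : (X ^ r - C (s ^ r * a) : F[X]) = C s ^ r * ((C s⁻¹ * X) ^ r - C a) := by
    rw [mul_pow, mul_sub, ← mul_assoc, hr, one_mul, C_mul, C_pow]
  have e2 : (X ^ 2 + C (s * b) * X + C (s ^ 2 * c) : F[X]) * C s⁻¹ ^ 2
      = (C s⁻¹ * X) ^ 2 + C b * (C s⁻¹ * X) + C c := by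
    simp only [C_mul, C_pow]
    linear_combination (C b * C s⁻¹ * X + C c * (C s * C s⁻¹ + 1)) * hss
  rw [e1, h2, ← e2]
  ring

theorem stmt_4 {F : Type*} [Field F] [Fintype F] (b c m : F)
    (hb : b ≠ 0) (hc : c ≠ 0) (hm : m ≠ 0) (j : ℕ) (hj : 0 < j) :
    qord (X ^ 2 + C b * X + C c : F[X]) =
      qord (X ^ 2 + C (m ^ j * b) * X + C (m ^ (2 * j) * c) : F[X]) := by
  have hs : m ^ j ≠ 0 := pow_ne_zero _ hm
  have e : m ^ (2 * j) = (m ^ j) ^ 2 := by rw [mul_comm, pow_mul]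
  rw [e]
  generalize m ^ j = s at hs
  unfold qord
  congr 1
  ext r
  constructor
  · rintro ⟨h0, a, ha, h⟩
    exact ⟨h0, s ^ r * a, mul_ne_zero (pow_ne_zero _ hs) ha, qord_aux b c s a hs r h⟩
  · rintro ⟨h0, a, ha, h⟩
    refine ⟨h0, s⁻¹ ^ r * a, mul_ne_zero (pow_ne_zero _ (inv_ne_zero hs)) ha, ?_⟩
    have h3 := qord_aux _ _ s⁻¹ a (inv_ne_zero hs) r h
    have e1 : s⁻¹ * (s * b) = b := by field_simp
    have e2 : s⁻¹ ^ 2 * (s ^ 2 * c) = c := by field_simp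
    rwa [e1, e2] at h3
end

section
/- Let F_q be a finite field of odd characteristic (q odd) and suppose f = x² + b·x + c ∈ F_q[x] is irreducible. Then the polynomial x² - b·x + c is also irreducible over F_q and divides x^{q+1} - c. -/
open Polynomial

theorem stmt_6 {F : Type*} [Field F] [Fintype F] (hq : Odd (Fintype.card F))
    (b c : F) (hirr : Irreducible (X ^ 2 + C b * X + C c : F[X])) :
    Irreducible (X ^ 2 - C b * X + C c : F[X]) ∧
      (X ^ 2 - C b * X + C c : F[X]) ∣ X ^ (Fintype.card F + 1) - C c := by
  have hd : (X ^ 2 - C b * X + C c : F[X]).natDegree = 2 := by compute_degree!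
  have hd' : (X ^ 2 + C b * X + C c : F[X]).natDegree = 2 := by compute_degree!
  have hno : ∀ x : F, x ^ 2 - b * x + c ≠ 0 := by
    intro x hx
    have h := (irreducible_iff_roots_eq_zero_of_degree_le_three
      (by rw [hd']) (by rw [hd']; norm_num)).1 hirr
    have : (-x) ∈ (X ^ 2 + C b * X + C c : F[X]).roots := by
      rw [mem_roots hirr.ne_zero]
      simp only [IsRoot, eval_add, eval_mul, eval_pow, eval_X, eval_C]
      linear_combination hx
    rw [h] at this
    simp at this
  have hg0 : (X ^ 2 - C b * X + C c : F[X]) ≠ 0 := by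
    intro h; rw [h] at hd; simp at hd
  have hg : Irreducible (X ^ 2 - C b * X + C c : F[X]) := by
    rw [irreducible_iff_roots_eq_zero_of_degree_le_three
      (by rw [hd]) (by rw [hd]; norm_num)]
    apply Multiset.eq_zero_of_forall_notMem
    intro x hx
    rw [mem_roots hg0] at hx
    apply hno x
    simpa [IsRoot] using hx
  refine ⟨hg, ?_⟩
  set q := Fintype.card F with hqd
  have h1 : (X ^ 2 - C b * X + C c : F[X]) ∣ (X ^ q - X) * (X ^ q + X - C b) := by
    have h := FiniteField.expand_card (X ^ 2 - C b * X + C c : F[X])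
    simp only [map_add, map_sub, map_mul, map_pow, expand_X, expand_C] at h
    rw [← hqd] at h
    have e : (X ^ q - X) * (X ^ q + X - C b) =
      (X ^ 2 - C b * X + C c : F[X]) ^ q - (X ^ 2 - C b * X + C c : F[X]) := by
      rw [← h]; ring
    rw [e]
    exact dvd_sub (dvd_pow_self _ Fintype.card_ne_zero) dvd_rfl
  rcases hg.prime.dvd_or_dvd h1 with h | h
  · exfalso
    have hs : (X ^ q - X : F[X]) = ∏ a : F, (X - C a) := by
      have hdeg := FiniteField.X_pow_card_sub_X_natDegree_eq F (Fintype.one_lt_card (α := F))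
      have hr := FiniteField.roots_X_pow_card_sub_X F
      have hm : (X ^ q - X : F[X]).Monic :=
        monic_X_pow_sub (by rw [degree_X]; exact_mod_cast Fintype.one_lt_card (α := F))
      have := prod_multiset_X_sub_C_of_monic_of_roots_card_eq hm
        (by rw [hqd, hdeg, hr]; rfl)
      rw [hqd, hr] at this
      exact this.symm
    rw [hs, hg.prime.dvd_finsetProd_iff] at h
    obtain ⟨a, -, ha⟩ := h
    have := natDegree_le_of_dvd ha (X_sub_C_ne_zero a)
    rw [hd, natDegree_X_sub_C] at this
    omega
  · have e : (X ^ (q + 1) - C c : F[X]) =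
      X * (X ^ q + X - C b) - (X ^ 2 - C b * X + C c) := by ring
    rw [e]
    exact dvd_sub (h.mul_left _) dvd_rfl
end

section
/- Let F_q be a finite field and let f = x² + b·x + c ∈ F_q[x] be irreducible. Suppose that one of the following holds: (a) q + 1 is a prime greater than 2; (b) q + 1 = 2^t for some positive integer t; (c) q + 1 = 2π for some odd prime π. Then f is primitive over F_q if and only if b ≠ 0 and c is a primitive element of F_q. -/
open Polynomial

/-- `α` is a primitive element of the field `F`, i.e. a generator of the
multiplicative group `F*`. -/
def IsPrimitiveElt {F : Type*} [Field F] (α : F) : Prop :=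
  ∀ x : F, x ≠ 0 → ∃ n : ℕ, x = α ^ n

/-- A monic polynomial `f` over `F_q` is primitive if it is the minimal polynomial over
`F_q` of a generator of the multiplicative group of `F_{q^m}` (`m = deg f`); equivalently,
`f` is monic irreducible and the root of `f` in `AdjoinRoot f ≅ F_{q^m}` generates the
multiplicative group of that field. -/
def IsPrimitivePoly {F : Type*} [Field F] (f : F[X]) : Prop :=
  f.Monic ∧ Irreducible f ∧
    ∀ y : AdjoinRoot f, y ≠ 0 → ∃ n : ℕ, y = (AdjoinRoot.root f) ^ n

lemma primElt_iff {K : Type*} [Field K] [Finite K] (a : K) (ha : a ≠ 0) :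
    (∀ x : K, x ≠ 0 → ∃ n : ℕ, x = a ^ n) ↔ orderOf a = Nat.card K - 1 := by
  obtain ⟨u, rfl⟩ : ∃ u : Kˣ, (u : K) = a := ⟨Units.mk0 a ha, rfl⟩
  rw [orderOf_units, ← Nat.card_units]
  constructor
  · intro h
    apply orderOf_eq_card_of_forall_mem_powers
    intro x
    obtain ⟨n, hn⟩ := h x x.ne_zero
    exact ⟨n, by ext; simp [hn]⟩
  · intro h x hx
    rw [← Nat.card_zpowers] at h
    have h2 := Subgroup.eq_top_of_card_eq _ h
    have h3 : Units.mk0 x hx ∈ Subgroup.zpowers u := by rw [h2]; trivial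
    rw [← mem_powers_iff_mem_zpowers] at h3
    obtain ⟨n, hn⟩ := h3
    exact ⟨n, by simpa using (congrArg Units.val hn).symm⟩

lemma num_aux (q n d : ℕ) (hq : 2 ≤ q) (hn : n = (q - 1) * d) (hd : d = Nat.gcd n (q + 1))
    (h2 : ¬ d ∣ 2)
    (hcond : ((q + 1).Prime ∧ 2 < q + 1) ∨
      (∃ t : ℕ, 0 < t ∧ q + 1 = 2 ^ t) ∨
      (∃ π : ℕ, π.Prime ∧ Odd π ∧ q + 1 = 2 * π)) : d = q + 1 := by
  have hdq : d ∣ q + 1 := hd ▸ Nat.gcd_dvd_right _ _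
  -- if `2 * d` divides `q + 1` and `q` is odd we get a contradiction
  have key : Odd q → ¬ 2 * d ∣ q + 1 := by
    rintro ⟨k, hk⟩ h
    have h3 : 2 * d ∣ n := ⟨k, by rw [hn, hk]; simp; ring⟩
    have h4 : 2 * d ∣ d := by
      conv_rhs => rw [hd]
      exact Nat.dvd_gcd h3 h
    have hd0 : 0 < d := Nat.pos_of_dvd_of_pos hdq (by omega)
    have := Nat.le_of_dvd hd0 h4
    omega
  rcases hcond with ⟨hp, -⟩ | ⟨t, ht, h⟩ | ⟨p, hp, hodd, h⟩
  · rcases (Nat.dvd_prime hp).1 hdq with h | h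
    · simp [h] at h2
    · exact h
  · have hqodd : Odd q := by
      obtain ⟨s, rfl⟩ := Nat.exists_eq_succ_of_ne_zero ht.ne'
      rw [pow_succ] at h
      exact ⟨2 ^ s - 1, by omega⟩
    have hk := key hqodd
    rw [h] at hdq hk
    obtain ⟨s, hs, rfl⟩ := (Nat.dvd_prime_pow Nat.prime_two).1 hdq
    rcases hs.eq_or_lt with rfl | hlt
    · exact h.symm
    · exact absurd (by rw [← pow_succ']; exact pow_dvd_pow 2 hlt) hk
  · have hk := key ⟨p - 1, by have := hp.pos; omega⟩
    rw [h] at hdq hk ⊢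
    have hpd : p ∣ d := by
      by_contra hnp
      exact h2 ((Nat.Coprime.symm ((Nat.Prime.coprime_iff_not_dvd hp).2 hnp)).dvd_of_dvd_mul_right hdq)
    obtain ⟨e, rfl⟩ := hpd
    have he : e ∣ 2 := by
      rw [mul_comm 2 p] at hdq
      exact Nat.dvd_of_mul_dvd_mul_left hp.pos hdq
    rcases (Nat.dvd_prime Nat.prime_two).1 he with rfl | rfl
    · simp at hk
    · ring

theorem stmt_10 {F : Type*} [Field F] [Fintype F] (b c : F)
    (hirr : Irreducible (X ^ 2 + C b * X + C c : F[X]))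
    (hcond : ((Fintype.card F + 1).Prime ∧ 2 < Fintype.card F + 1) ∨
      (∃ t : ℕ, 0 < t ∧ Fintype.card F + 1 = 2 ^ t) ∨
      (∃ π : ℕ, π.Prime ∧ Odd π ∧ Fintype.card F + 1 = 2 * π)) :
    IsPrimitivePoly (X ^ 2 + C b * X + C c : F[X]) ↔ b ≠ 0 ∧ IsPrimitiveElt c := by
  have hmon : (X ^ 2 + C b * X + C c : F[X]).Monic := by monicity!
  have hdeg : (X ^ 2 + C b * X + C c : F[X]).natDegree = 2 := by compute_degree!
  have hc0 : c ≠ 0 := by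
    rintro rfl
    have := degree_eq_one_of_irreducible_of_root hirr (x := 0) (by simp)
    rw [degree_eq_natDegree hmon.ne_zero, hdeg] at this
    norm_num at this
  have hroot : (AdjoinRoot.root (X ^ 2 + C b * X + C c : F[X])) ^ 2
      + algebraMap F _ b * AdjoinRoot.root (X ^ 2 + C b * X + C c : F[X])
      + algebraMap F _ c = 0 := by
    have := AdjoinRoot.aeval_eq (f := (X ^ 2 + C b * X + C c : F[X])) (X ^ 2 + C b * X + C c : F[X])
    rw [AdjoinRoot.mk_self] at this
    simpa only [map_add, map_mul, map_pow, aeval_X, aeval_C] using this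
  unfold IsPrimitivePoly IsPrimitiveElt
  simp only [hmon, hirr, true_and]
  have hext : ∀ φ ψ : AdjoinRoot (X ^ 2 + C b * X + C c : F[X]) →ₐ[F]
      AdjoinRoot (X ^ 2 + C b * X + C c : F[X]), φ (AdjoinRoot.root _) = ψ (AdjoinRoot.root _) →
      φ = ψ := fun φ ψ h => AdjoinRoot.algHom_ext h
  have hfin : Module.finrank F (AdjoinRoot (X ^ 2 + C b * X + C c : F[X])) = 2 :=
    finrank_quotient_span_eq_natDegree.trans hdeg
  generalize (X ^ 2 + C b * X + C c : F[X]) = f at *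
  have : Fact (Irreducible f) := ⟨hirr⟩
  generalize hα : AdjoinRoot.root f = α at *
  have : Module.Finite F (AdjoinRoot f) := Module.finite_of_finrank_pos (by omega)
  have : Finite (AdjoinRoot f) := Module.finite_of_finite F
  have hcard : Nat.card (AdjoinRoot f) = Nat.card F ^ 2 := by
    rw [← hfin]; exact Module.natCard_eq_pow_finrank
  have hq : 2 ≤ Fintype.card F := Fintype.one_lt_card
  have hα0 : α ≠ 0 := by
    rintro rfl
    apply hc0
    simpa using hroot
  have hfrob : α ^ Fintype.card F ≠ α := by
    intro h
    have h1 : FiniteField.frobeniusAlgHom F (AdjoinRoot f) = 1 := hext _ _ (by simpa using h)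
    have h2 := FiniteField.orderOf_frobeniusAlgHom F (AdjoinRoot f)
    rw [h1, hfin] at h2
    simp at h2
  have hβ : α ^ Fintype.card F = - algebraMap F _ b - α := by
    have h := congrArg (FiniteField.frobeniusAlgHom F (AdjoinRoot f)) hroot
    simp only [map_add, map_mul, map_pow, AlgHom.commutes, map_zero] at h
    simp only [FiniteField.coe_frobeniusAlgHom] at h
    have h3 : (α ^ Fintype.card F - α) * (α ^ Fintype.card F - (- algebraMap F _ b - α)) = 0 := by
      linear_combination h - hroot
    rcases mul_eq_zero.1 h3 with h | h
    · exact absurd (sub_eq_zero.1 h) hfrob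
    · exact sub_eq_zero.1 h
  have hnorm : α ^ (Fintype.card F + 1) = algebraMap F _ c := by
    rw [pow_succ, hβ]
    linear_combination -hroot
  have hord : orderOf c = orderOf α / Nat.gcd (orderOf α) (Fintype.card F + 1) := by
    rw [← orderOf_pow' _ (by omega), hnorm]
    exact (orderOf_injective (algebraMap F (AdjoinRoot f)).toMonoidHom
      (algebraMap F (AdjoinRoot f)).injective c).symm
  rw [primElt_iff α hα0, primElt_iff c hc0, hcard, Nat.card_eq_fintype_card, hord]
  have hsq : Fintype.card F ^ 2 - 1 = (Fintype.card F - 1) * (Fintype.card F + 1) := by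
    rw [mul_comm]; simpa using Nat.sq_sub_sq (Fintype.card F) 1
  rw [hsq]
  have hsq2 : b ≠ 0 → ¬ orderOf α ∣ (Fintype.card F - 1) * 2 := by
    intro hb h
    rw [orderOf_dvd_iff_pow_eq_one] at h
    have h1 : (α ^ Fintype.card F) ^ 2 = α ^ 2 := by
      rw [← pow_mul, show Fintype.card F * 2 = (Fintype.card F - 1) * 2 + 2 by omega, pow_add, h,
        one_mul]
    rw [sq_eq_sq_iff_eq_or_eq_neg] at h1
    rcases h1 with h1 | h1
    · exact hfrob h1
    · rw [hβ] at h1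
      apply hb
      have : algebraMap F (AdjoinRoot f) b = 0 := by linear_combination -h1
      simpa using this
  constructor
  · intro h
    constructor
    · rintro rfl
      have h1 : α ^ ((Fintype.card F - 1) * 2) = 1 := by
        have h2 : α ^ 2 = algebraMap F _ (-c) := by
          simp at hroot ⊢
          linear_combination hroot
        rw [mul_comm, pow_mul, h2, ← map_pow,
          FiniteField.pow_card_sub_one_eq_one _ (neg_ne_zero.2 hc0), map_one]
      have h2 := orderOf_dvd_of_pow_eq_one h1
      rw [h] at h2
      have h3 := Nat.le_of_dvd (by omega) (Nat.dvd_of_mul_dvd_mul_left (by omega) h2)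
      omega
    · rw [h, Nat.gcd_eq_right (Dvd.intro_left _ rfl), Nat.mul_div_cancel _ (by omega)]
  · rintro ⟨hb, h⟩
    have hn := Nat.div_mul_cancel (Nat.gcd_dvd_left (orderOf α) (Fintype.card F + 1))
    rw [h] at hn
    have := num_aux _ _ _ hq hn.symm rfl (fun h2 => hsq2 hb (by
      rw [← hn]; exact mul_dvd_mul_left _ h2)) hcond
    rw [this] at hn
    exact hn.symm
end

section
/- Let F_q be a finite field with q even such that q + 1 is prime, let F_{q^2} be its quadratic extension, and let c be a primitive element of F_q. Then every element r ∈ F_{q^2} \ F_q with r^{q+1} = c is a primitive element of F_{q^2}. -/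
open Polynomial

theorem stmt_11 {F K : Type*} [Field F] [Fintype F] [Field K] [Fintype K]
    [Algebra F K] (hrank : Module.finrank F K = 2)
    (heven : Even (Fintype.card F)) (hprime : (Fintype.card F + 1).Prime)
    (c : F) (hc : IsPrimitiveElt c)
    (r : K) (hr : r ∉ Set.range (algebraMap F K))
    (hnorm : r ^ (Fintype.card F + 1) = algebraMap F K c) :
    IsPrimitiveElt r := by
  classical
  have hr0 : r ≠ 0 := by
    rintro rfl
    exact hr ⟨0, map_zero _⟩
  have hc0 : c ≠ 0 := by
    rintro rfl
    rw [map_zero] at hnorm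
    exact pow_ne_zero _ hr0 hnorm
  have hq : 1 < Fintype.card F := Fintype.one_lt_card
  have hcK : Fintype.card K = Fintype.card F ^ 2 := by
    rw [← hrank]; exact Module.card_eq_pow_finrank
  have hoc : orderOf (Units.mk0 c hc0) = Fintype.card F - 1 := by
    rw [← Fintype.card_units, ← Nat.card_eq_fintype_card]
    apply orderOf_eq_card_of_forall_mem_zpowers
    intro x
    obtain ⟨n, hn⟩ := hc x x.ne_zero
    refine ⟨n, ?_⟩
    ext
    simp [hn]
  have hoc' : orderOf (algebraMap F K c) = Fintype.card F - 1 := by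
    rw [← hoc, ← orderOf_units, Units.val_mk0]
    exact orderOf_injective (algebraMap F K).toMonoidHom (algebraMap F K).injective c
  set q := Fintype.card F with hqdef
  have hor : orderOf r = (q - 1) * (q + 1) := by
    have h1 : orderOf (r ^ (q + 1)) = orderOf r / Nat.gcd (orderOf r) (q + 1) :=
      orderOf_pow' r (by omega)
    rw [hnorm, hoc'] at h1
    have h2 := Nat.div_mul_cancel (Nat.gcd_dvd_left (orderOf r) (q + 1))
    rw [← h1] at h2
    rcases (Nat.dvd_prime hprime).1 (Nat.gcd_dvd_right (orderOf r) (q + 1)) with h | h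
    · exfalso
      rw [h, mul_one] at h2
      have hp : IsPrimitiveRoot (algebraMap F K c) (q - 1) := hoc' ▸ IsPrimitiveRoot.orderOf _
      haveI : NeZero (q - 1) := ⟨by omega⟩
      obtain ⟨i, -, hi⟩ := hp.eq_pow_of_pow_eq_one (ξ := r) (by rw [h2]; exact pow_orderOf_eq_one r)
      exact hr ⟨c ^ i, by rw [map_pow, hi]⟩
    · rw [h] at h2
      exact h2.symm
  intro x hx
  have hp : IsPrimitiveRoot r (orderOf r) := IsPrimitiveRoot.orderOf _
  haveI : NeZero (orderOf r) := ⟨by rw [hor]; exact Nat.mul_ne_zero (by omega) (by omega)⟩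
  obtain ⟨i, -, hi⟩ := hp.eq_pow_of_pow_eq_one (ξ := x) (by
    have h3 : orderOf r = Fintype.card K - 1 := by
      rw [hor, hcK, mul_comm, ← Nat.sq_sub_sq, one_pow]
    rw [h3]
    exact FiniteField.pow_card_sub_one_eq_one x hx)
  exact ⟨i, hi.symm⟩
end

section
/- Let F_q be a finite field with q odd such that q + 1 = 2^t for some positive integer t, let F_{q^2} be its quadratic extension, and let c be a primitive element of F_q. Then every element r ∈ F_{q^2} with r^{q+1} = c is a primitive element of F_{q^2}. -/
open Polynomial

theorem stmt_12 {F K : Type*} [Field F] [Fintype F] [Field K] [Fintype K]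
    [Algebra F K] (hrank : Module.finrank F K = 2)
    (hodd : Odd (Fintype.card F)) (t : ℕ) (ht : 0 < t)
    (hpow : Fintype.card F + 1 = 2 ^ t)
    (c : F) (hc : IsPrimitiveElt c)
    (r : K) (hnorm : r ^ (Fintype.card F + 1) = algebraMap F K c) :
    IsPrimitiveElt r := by
  classical
  have hq2 : 1 < Fintype.card F := Fintype.one_lt_card
  have hq3 : 3 ≤ Fintype.card F := by
    rcases hodd with ⟨k, hk⟩; omega
  have hc0 : c ≠ 0 := by
    rintro rfl
    have hsub : (Finset.univ : Finset F) ⊆ {0, 1} := by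
      intro x _
      by_cases hx : x = 0
      · simp [hx]
      · obtain ⟨n, hn⟩ := hc x hx
        rcases Nat.eq_zero_or_pos n with h | h
        · simp [hn, h]
        · exact absurd (by rw [hn, zero_pow h.ne']) hx
    have h1 := Finset.card_le_card hsub
    have h2 : ({0, 1} : Finset F).card ≤ 2 := Finset.card_le_two
    rw [Finset.card_univ] at h1
    omega
  have hcord : orderOf c = Fintype.card F - 1 := by
    have h := orderOf_eq_card_of_forall_mem_powers (g := Units.mk0 c hc0) (by
      intro x
      obtain ⟨n, hn⟩ := hc x x.ne_zero
      exact ⟨n, by ext; simp [hn]⟩)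
    rw [← Fintype.card_units, ← Nat.card_eq_fintype_card, ← h, ← orderOf_units]
    simp
  have hr0 : r ≠ 0 := by
    rintro rfl
    rw [zero_pow (by omega)] at hnorm
    exact hc0 ((map_eq_zero (algebraMap F K)).1 hnorm.symm)
  have hcK : orderOf (r ^ (2 ^ t)) = Fintype.card F - 1 := by
    rw [← hpow, hnorm, ← hcord]
    exact orderOf_injective (algebraMap F K).toMonoidHom (algebraMap F K).injective c
  rw [orderOf_pow' r (by positivity)] at hcK
  have hgd : Nat.gcd (orderOf r) (2 ^ t) ∣ orderOf r := Nat.gcd_dvd_left _ _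
  have hd : orderOf r = (Fintype.card F - 1) * Nat.gcd (orderOf r) (2 ^ t) := by
    rw [← hcK]; exact (Nat.div_mul_cancel hgd).symm
  obtain ⟨s, hst, hs⟩ := (Nat.dvd_prime_pow Nat.prime_two).1 (Nat.gcd_dvd_right (orderOf r) (2 ^ t))
  have hst' : s = t := by
    by_contra hne
    have hlt : s + 1 ≤ t := by omega
    obtain ⟨k, hk⟩ := hodd
    have h1 : 2 ^ (s + 1) ∣ orderOf r := by
      rw [hd, hs]
      exact ⟨k, by rw [hk, Nat.add_sub_cancel]; ring⟩
    have h2 := Nat.dvd_gcd h1 (pow_dvd_pow 2 hlt)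
    rw [hs, Nat.pow_dvd_pow_iff_le_right (by norm_num)] at h2
    omega
  have hcard : Fintype.card K = Fintype.card F ^ 2 := by
    rw [Module.card_eq_pow_finrank (K := F) (V := K), hrank]
  have hr : orderOf (Units.mk0 r hr0) = Nat.card Kˣ := by
    rw [← orderOf_units, Units.val_mk0, hd, hs, hst', ← hpow, Nat.card_eq_fintype_card,
      Fintype.card_units, hcard]
    obtain ⟨m, hm⟩ := Nat.exists_eq_add_of_lt hq2
    rw [hm]
    have : (1 + m + 1) ^ 2 = (1 + m + 1 - 1) * (1 + m + 1 + 1) + 1 := by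
      rw [Nat.add_sub_cancel]; ring
    omega
  intro x hx
  have htop : Subgroup.zpowers (Units.mk0 r hr0) = ⊤ :=
    Subgroup.eq_top_of_card_eq _ (by rw [Nat.card_zpowers, hr])
  have hmem : Units.mk0 x hx ∈ Submonoid.powers (Units.mk0 r hr0) := by
    rw [mem_powers_iff_mem_zpowers, htop]
    exact Subgroup.mem_top _
  obtain ⟨n, hn⟩ := hmem
  exact ⟨n, by simpa using (congrArg Units.val hn).symm⟩
end

section
/- Let F_q be a finite field with q odd such that q + 1 = 2π for some odd prime π, let F_{q^2} be its quadratic extension, and let c be a primitive element of F_q. Then an element r ∈ F_{q^2} with r^{q+1} = c is a primitive element of F_{q^2} if and only if r² ≠ -c. -/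
open Polynomial

theorem prim_iff_order {L : Type*} [Field L] [Fintype L] (a : L) (ha : a ≠ 0) :
    IsPrimitiveElt a ↔ orderOf a = Fintype.card L - 1 := by
  classical
  obtain ⟨u, rfl⟩ : ∃ u : Lˣ, (u : L) = a := ⟨Units.mk0 a ha, rfl⟩
  rw [orderOf_units, ← Fintype.card_units, ← Nat.card_eq_fintype_card]
  constructor
  · intro h
    apply orderOf_eq_card_of_forall_mem_zpowers
    intro x
    obtain ⟨n, hn⟩ := h x x.ne_zero
    refine ⟨n, ?_⟩
    ext
    simp [hn]
  · intro h x hx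
    have htop : Subgroup.zpowers u = ⊤ := by
      apply Subgroup.eq_top_of_card_eq
      rw [Nat.card_zpowers, h]
    have hm : Units.mk0 x hx ∈ Subgroup.zpowers u := by rw [htop]; trivial
    rw [← mem_powers_iff_mem_zpowers] at hm
    obtain ⟨n, hn⟩ := hm
    refine ⟨n, ?_⟩
    have := congrArg Units.val hn
    simpa using this.symm

theorem stmt_13 {F K : Type*} [Field F] [Fintype F] [Field K] [Fintype K]
    [Algebra F K] (hrank : Module.finrank F K = 2)
    (hodd : Odd (Fintype.card F)) (π : ℕ) (hπ : π.Prime) (hπodd : Odd π)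
    (hq1 : Fintype.card F + 1 = 2 * π)
    (c : F) (hc : IsPrimitiveElt c)
    (r : K) (hnorm : r ^ (Fintype.card F + 1) = algebraMap F K c) :
    IsPrimitiveElt r ↔ r ^ 2 ≠ algebraMap F K (-c) := by
  obtain ⟨q, hq⟩ : ∃ q, q = Fintype.card F := ⟨_, rfl⟩
  have hK : Fintype.card K = q ^ 2 := by
    rw [Module.card_eq_pow_finrank (K := F) (V := K), hrank, hq]
  rw [← hq] at hodd hq1 hnorm
  have hπ3 : 3 ≤ π := by
    have := hπ.two_le
    obtain ⟨k, hk⟩ := hπodd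
    omega
  have hq5 : 5 ≤ q := by omega
  have hc0 : c ≠ 0 := by
    rintro rfl
    have : Fintype.card F ≤ Fintype.card Bool := by
      classical
      refine Fintype.card_le_of_injective (fun x : F => decide (x = 0)) ?_
      have key : ∀ x : F, x ≠ 0 → x = 1 := by
        intro x hx
        obtain ⟨n, hn⟩ := hc x hx
        rcases Nat.eq_zero_or_pos n with h | h
        · simpa [h] using hn
        · rw [zero_pow h.ne'] at hn
          exact absurd hn hx
      intro x y hxy
      simp only [decide_eq_decide] at hxy
      by_cases hx : x = 0
      · rw [hx, hxy.1 hx]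
      · rw [key x hx, key y (fun h => hx (hxy.2 h))]
    rw [Fintype.card_bool] at this
    omega
  have hr0 : r ≠ 0 := by
    rintro rfl
    rw [zero_pow (by omega)] at hnorm
    exact hc0 ((map_eq_zero (algebraMap F K)).1 hnorm.symm)
  have hco := (prim_iff_order c hc0).1 hc
  rw [← hq] at hco
  have hco' : orderOf (algebraMap F K c) = q - 1 := by
    rw [← hco]
    exact orderOf_injective (algebraMap F K).toMonoidHom (algebraMap F K).injective c
  rw [prim_iff_order r hr0, hK]
  obtain ⟨m, rfl⟩ : ∃ m, q = m + 1 := ⟨q - 1, by omega⟩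
  simp only [Nat.add_sub_cancel] at hco hco'
  have hsq : (m + 1) ^ 2 - 1 = m * (m + 2) := by
    have : (m + 1) ^ 2 = m * (m + 2) + 1 := by ring
    omega
  rw [hsq]
  constructor
  · intro ho h
    have h1 : r ^ (2 * m) = 1 := by
      rw [pow_mul, h, ← map_pow, Even.neg_pow (by obtain ⟨k, hk⟩ := hodd; exact ⟨k, by omega⟩),
        ← hco, pow_orderOf_eq_one, map_one]
    have h2 := Nat.le_of_dvd (by omega) (orderOf_dvd_of_pow_eq_one h1)
    rw [ho] at h2
    nlinarith
  · intro hne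
    have h1 := orderOf_pow' r (n := m + 1 + 1) (by omega)
    rw [hnorm, hco'] at h1
    have hgd : (orderOf r).gcd (m + 1 + 1) ∣ orderOf r := Nat.gcd_dvd_left _ _
    have hn : orderOf r = m * (orderOf r).gcd (m + 1 + 1) := by
      have h5 := Nat.div_mul_cancel hgd
      rw [← h1] at h5
      exact h5.symm
    have h2n : 2 ∣ orderOf r := by
      rw [hn]
      apply Dvd.dvd.mul_right
      obtain ⟨k, hk⟩ := hodd
      exact ⟨k, by omega⟩
    have h2g : 2 ∣ (orderOf r).gcd (m + 1 + 1) := Nat.dvd_gcd h2n ⟨π, hq1⟩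
    have hg2 : (orderOf r).gcd (m + 1 + 1) ∣ m + 1 + 1 := Nat.gcd_dvd_right _ _
    obtain ⟨t, ht⟩ := h2g
    rw [ht] at hn hg2
    rw [hq1] at hg2
    have htp : t ∣ π := Nat.dvd_of_mul_dvd_mul_left (by norm_num) hg2
    rcases (Nat.dvd_prime hπ).1 htp with h | h
    · exfalso
      apply hne
      rw [h, mul_one] at hn
      have h3 : (r ^ m) ^ 2 = 1 := by rw [← pow_mul, ← hn, pow_orderOf_eq_one]
      rcases (sq_eq_sq_iff_eq_or_eq_neg.1 (h3.trans (one_pow 2).symm)) with h4 | h4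
      · have := Nat.le_of_dvd (by omega) (orderOf_dvd_of_pow_eq_one h4)
        omega
      · rw [map_neg, ← hnorm, add_assoc, pow_add, h4]
        ring
    · rw [hn, h, ← hq1]
end

section
/- Let F_q be a finite field and let f = x² + b·x + c ∈ F_q[x] be irreducible. Suppose q + 1 is not a prime, not a power of 2, and not twice an odd prime. Let p be the smallest odd prime dividing q + 1, set e = (q+1)/p + 1, and let h ∈ F_q[x] be the quotient upon dividing x^e by f (so x^e = f·h + r with deg(r) < 2). Then f is primitive over F_q if and only if b ≠ 0, c is a primitive element of F_q, and all of the (q+1)/p coefficients of h in degrees 0, 1, ..., e - 2 are nonzero. -/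
open Polynomial

theorem aux_fixed {F K : Type*} [Field F] [Fintype F] [Field K] [Algebra F K] (x : K)
    (hx : x ^ Fintype.card F = x) : ∃ a : F, algebraMap F K a = x := by
  classical
  by_contra hcon
  push Not at hcon
  have h1 : 1 < Fintype.card F := Fintype.one_lt_card
  let S : Finset K := insert x (Finset.univ.image (algebraMap F K))
  have hS : S.card = Fintype.card F + 1 := by
    rw [Finset.card_insert_of_notMem (by simpa using hcon),
      Finset.card_image_of_injective _ (algebraMap F K).injective, Finset.card_univ]
  have hne := FiniteField.X_pow_card_sub_X_ne_zero K h1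
  have hle : S.card ≤ (X ^ Fintype.card F - X : K[X]).natDegree := by
    apply Polynomial.card_le_degree_of_subset_roots
    intro y hy
    have hy' : y ∈ S := hy
    rw [Polynomial.mem_roots hne]
    simp only [S, Finset.mem_insert, Finset.mem_image, Finset.mem_univ, true_and] at hy'
    rcases hy' with rfl | ⟨a, rfl⟩
    · simp [Polynomial.IsRoot, hx]
    · simp [Polynomial.IsRoot, ← map_pow, FiniteField.pow_card]
  rw [FiniteField.X_pow_card_sub_X_natDegree_eq K h1, hS] at hle
  omega

theorem aux_prim {K : Type*} [Field K] [Fintype K] (a : K) (ha : a ≠ 0) :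
    IsPrimitiveElt a ↔ orderOf a = Fintype.card K - 1 := by
  classical
  obtain ⟨u, rfl⟩ : ∃ u : Kˣ, (u : K) = a := ⟨Units.mk0 a ha, rfl⟩
  rw [orderOf_units, ← Fintype.card_units, ← Nat.card_eq_fintype_card]
  constructor
  · intro h
    apply orderOf_eq_card_of_forall_mem_powers
    intro x
    obtain ⟨n, hn⟩ := h x x.ne_zero
    exact ⟨n, by ext; simp [hn]⟩
  · intro h x hx
    have htop : Subgroup.zpowers u = ⊤ := by
      apply Subgroup.eq_top_of_card_eq
      rw [Nat.card_zpowers, h]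
    have hm : Units.mk0 x hx ∈ Subgroup.zpowers u := by rw [htop]; trivial
    rw [← mem_powers_iff_mem_zpowers] at hm
    obtain ⟨n, hn⟩ := hm
    refine ⟨n, ?_⟩
    have := congrArg (fun v : Kˣ => (v : K)) hn
    simpa using this.symm

theorem aux_coeff {F K : Type*} [Field F] [Field K] [Algebra F K] (b c : F) (α : K)
    (hα : α ^ 2 + algebraMap F K b * α + algebraMap F K c = 0) (d : ℕ) :
    ∀ (k : ℕ) (h r : F[X]), (X : F[X]) ^ (k + d + 1) = (X ^ 2 + C b * X + C c) * h + r →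
      r.degree < 2 →
      ∃ t : F, α ^ k = algebraMap F K (h.coeff d) * α + algebraMap F K t := by
  have key : ∀ (k : ℕ) (h r : F[X]), (X : F[X]) ^ (k + 1) = (X ^ 2 + C b * X + C c) * h + r →
      r.degree < 2 → (X : F[X]) ^ k = (X ^ 2 + C b * X + C c) * h.divX +
        (C (h.coeff 0) * X + C (b * h.coeff 0 + r.coeff 1)) := by
    intro k h r hk hr
    have hr1 : r = C (r.coeff 1) * X + C (r.coeff 0) :=
      Polynomial.eq_X_add_C_of_degree_le_one (by
        have h2 : r.degree < ((2 : ℕ) : WithBot ℕ) := by exact_mod_cast hr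
        rw [Polynomial.degree_lt_iff_coeff_zero] at h2
        rw [Polynomial.degree_le_iff_coeff_zero]
        intro m hm
        apply h2
        have : 1 < m := by exact_mod_cast hm
        omega)
    have h0 : c * h.coeff 0 + r.coeff 0 = 0 := by
      have := congrArg (fun P => Polynomial.eval 0 P) hk
      simp [← Polynomial.coeff_zero_eq_eval_zero] at this
      simp [Polynomial.coeff_zero_eq_eval_zero] at this ⊢
      exact this.symm
    have h0' : (C c * C (h.coeff 0) + C (r.coeff 0) : F[X]) = 0 := by
      rw [← C_mul, ← C_add, h0, C_0]
    have hh := Polynomial.divX_mul_X_add h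
    apply mul_right_cancel₀ (Polynomial.X_ne_zero (R := F))
    rw [← pow_succ, hk]
    simp only [C_add, C_mul]
    linear_combination (-(X ^ 2 + C b * X + C c)) * hh + hr1 + h0'
  induction d with
  | zero =>
    intro k h r hk hr
    have := congrArg (Polynomial.aeval α) (key k h r hk hr)
    refine ⟨b * h.coeff 0 + r.coeff 1, ?_⟩
    simpa [hα] using this
  | succ d ih =>
    intro k h r hk hr
    obtain ⟨t, ht⟩ := ih k h.divX _ (key (k + d + 1) h r hk hr)
      (lt_of_le_of_lt Polynomial.degree_linear_le (by norm_num))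
    exact ⟨t, by simpa using ht⟩

theorem aux_nat (q p m : ℕ) (hp : p.Prime) (hpdvd : p ∣ q + 1)
    (hpmin : ∀ p' : ℕ, p'.Prime → Odd p' → p' ∣ q + 1 → p ≤ p')
    (hm : m ∣ q + 1) (hlt : (q + 1) / p < m) : m = q + 1 ∨ (2 ∣ q + 1 ∧ m ∣ (q + 1) / 2) := by
  obtain ⟨k, hk⟩ := hm
  by_cases hk1 : k = 1
  · left; simp [hk, hk1]
  right
  obtain ⟨l, hl, hlk⟩ := Nat.exists_prime_and_dvd hk1
  have hkp : k < p := by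
    rw [Nat.div_lt_iff_lt_mul hp.pos, hk] at hlt
    exact lt_of_mul_lt_mul_left hlt (Nat.zero_le _)
  have hkpos : 0 < k := by
    rcases Nat.eq_zero_or_pos k with h | h
    · subst h; simp at hk
    · exact h
  have hl2 : l = 2 := by
    rcases hl.eq_two_or_odd' with h | h
    · exact h
    · have := hpmin l hl h (hk ▸ Dvd.dvd.mul_left hlk m)
      have := Nat.le_of_dvd hkpos hlk
      omega
  subst hl2
  obtain ⟨j, rfl⟩ := hlk
  have : q + 1 = 2 * (m * j) := by rw [hk]; ring
  refine ⟨⟨_, this⟩, j, ?_⟩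
  omega

theorem stmt_14 {F : Type*} [Field F] [Fintype F] (b c : F)
    (hirr : Irreducible (X ^ 2 + C b * X + C c : F[X]))
    (hnp : ¬ (Fintype.card F + 1).Prime)
    (hn2 : ¬ ∃ t : ℕ, Fintype.card F + 1 = 2 ^ t)
    (hn2π : ¬ ∃ π : ℕ, π.Prime ∧ Odd π ∧ Fintype.card F + 1 = 2 * π)
    (p : ℕ) (hp : p.Prime) (hpodd : Odd p) (hpdvd : p ∣ Fintype.card F + 1)
    (hpmin : ∀ p' : ℕ, p'.Prime → Odd p' → p' ∣ Fintype.card F + 1 → p ≤ p')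
    (e : ℕ) (he : e = (Fintype.card F + 1) / p + 1)
    (h r : F[X]) (hdiv : (X : F[X]) ^ e = (X ^ 2 + C b * X + C c) * h + r)
    (hr : r.degree < 2) :
    IsPrimitivePoly (X ^ 2 + C b * X + C c : F[X]) ↔
      b ≠ 0 ∧ IsPrimitiveElt c ∧ ∀ d : ℕ, d ≤ e - 2 → h.coeff d ≠ 0 := by
  classical
  set f : F[X] := X ^ 2 + C b * X + C c with hf
  set q := Fintype.card F with hq
  have hq1 : 1 < q := Fintype.one_lt_card
  have hmonic : f.Monic := by rw [hf]; monicity!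
  have hdeg : f.natDegree = 2 := by rw [hf]; compute_degree!
  haveI : Fact (Irreducible f) := ⟨hirr⟩
  let K := AdjoinRoot f
  let φ : F →+* K := algebraMap F K
  have hφ : Function.Injective φ := φ.injective
  let α : K := AdjoinRoot.root f
  have hα : α ^ 2 + φ b * α + φ c = 0 := by
    have h1 : Polynomial.eval₂ (AdjoinRoot.of f) (AdjoinRoot.root f)
        (X ^ 2 + C b * X + C c) = 0 := AdjoinRoot.eval₂_root f
    simp only [eval₂_add, eval₂_mul, eval₂_pow, eval₂_X, eval₂_C] at h1
    exact h1
  let pb := AdjoinRoot.powerBasis (K := F) hirr.ne_zero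
  haveI : Module.Finite F K := pb.finite
  haveI : Finite K := Module.finite_of_finite F
  haveI : Fintype K := Fintype.ofFinite K
  have hcard : Fintype.card K = q ^ 2 := by
    rw [Module.card_eq_pow_finrank (K := F) (V := K), pb.finrank, AdjoinRoot.powerBasis_dim, hdeg]
  have hαF : ∀ a : F, φ a ≠ α := by
    intro a ha
    rw [← ha] at hα
    have h0 : f.IsRoot a := by
      apply hφ
      simpa [hf, Polynomial.IsRoot] using hα
    have := Polynomial.degree_eq_one_of_irreducible_of_root hirr h0
    rw [Polynomial.degree_eq_natDegree hirr.ne_zero, hdeg] at this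
    norm_num at this
  have hα0 : α ≠ 0 := fun h => hαF 0 (by simp [h])
  have hc : α ^ (q + 1) = φ c := by
    have h1 := congrArg (FiniteField.frobeniusAlgHom F K) hα
    have hfb : ∀ a : F, FiniteField.frobeniusAlgHom F K (φ a) = φ a := fun a =>
      (FiniteField.frobeniusAlgHom F K).commutes a
    have hfα : FiniteField.frobeniusAlgHom F K α = α ^ q := rfl
    rw [map_add, map_add, map_mul, map_pow, hfb, hfb, hfα, map_zero] at h1
    have hne : α ^ q - α ≠ 0 := by
      intro h0
      obtain ⟨a, ha⟩ := aux_fixed (F := F) α (sub_eq_zero.mp h0)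
      exact hαF a ha
    have h2 : α ^ q + α + φ b = 0 := by
      apply mul_left_cancel₀ hne
      linear_combination h1 - hα
    rw [pow_succ]
    linear_combination α * h2 - hα
  have hmem : ∀ k : ℕ, (α ^ (q - 1)) ^ k = 1 ↔ ∃ a : F, φ a = α ^ k := by
    intro k
    rw [← pow_mul, mul_comm, pow_mul]
    constructor
    · intro h1
      apply aux_fixed (F := F)
      have : q = (q - 1) + 1 := by omega
      rw [← hq, this, pow_succ, h1, one_mul]
    · rintro ⟨a, ha⟩
      have ha0 : a ≠ 0 := by
        rintro rfl
        rw [map_zero] at ha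
        exact pow_ne_zero k hα0 ha.symm
      rw [← ha, ← map_pow, FiniteField.pow_card_sub_one_eq_one a ha0, map_one]
  have hco : ∀ d : ℕ, d ≤ e - 2 → (h.coeff d = 0 ↔ (α ^ (q - 1)) ^ (e - 1 - d) = 1) := by
    intro d hd
    have hN : 0 < (q + 1) / p := Nat.div_pos (Nat.le_of_dvd (by omega) hpdvd) hp.pos
    have he2 : e = (e - 1 - d) + d + 1 := by omega
    rw [he2] at hdiv
    obtain ⟨t, ht⟩ := aux_coeff (K := K) b c α hα d _ h r hdiv hr
    rw [hmem]
    constructor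
    · intro h0
      rw [h0, map_zero, zero_mul, zero_add] at ht
      exact ⟨t, ht.symm⟩
    · rintro ⟨a, ha⟩
      by_contra hne
      apply hαF ((a - t) / h.coeff d)
      have hne' : φ (h.coeff d) ≠ 0 := by simpa using hne
      rw [map_div₀, map_sub, div_eq_iff hne', ha]
      change α ^ _ = φ _ * α + φ t at ht
      linear_combination ht
  have hc0 : c ≠ 0 := by
    rintro rfl
    rw [map_zero] at hc
    exact pow_ne_zero _ hα0 hc
  have hordc : orderOf c = orderOf (α ^ (q + 1)) := by
    rw [hc]
    exact (orderOf_injective (φ : F →* K) hφ c).symm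
  have hsq : q ^ 2 - 1 = (q + 1) * (q - 1) := by
    have := Nat.sq_sub_sq q 1
    simpa using this
  have hfp : IsPrimitivePoly f ↔ orderOf α = (q + 1) * (q - 1) := by
    rw [← hsq, ← hcard, ← aux_prim α hα0]
    exact ⟨fun H => H.2.2, fun H => ⟨hmonic, hirr, H⟩⟩
  rw [hfp, aux_prim c hc0, hordc, ← hq]
  have hq1' : 0 < q - 1 := by omega
  constructor
  · intro ho
    have hm : orderOf (α ^ (q - 1)) = q + 1 := by
      rw [orderOf_pow_of_dvd hq1'.ne' (ho ▸ Dvd.intro_left _ rfl), ho, Nat.mul_div_cancel _ hq1']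
    refine ⟨?_, ?_, ?_⟩
    · rintro hb
      have h2 : (α ^ (q - 1)) ^ 2 = 1 := by
        rw [hmem]
        refine ⟨-c, ?_⟩
        rw [hb, map_zero] at hα
        rw [map_neg]
        linear_combination -hα
      have := Nat.le_of_dvd (by norm_num) (orderOf_dvd_of_pow_eq_one h2)
      omega
    · rw [orderOf_pow_of_dvd (by omega) (ho ▸ Dvd.intro _ rfl), ho,
        Nat.mul_div_cancel_left _ (by omega)]
    · intro d hd h0
      rw [hco d hd] at h0
      have hN : 0 < (q + 1) / p := Nat.div_pos (Nat.le_of_dvd (by omega) hpdvd) hp.pos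
      have h3 := Nat.le_of_dvd (by omega) (orderOf_dvd_of_pow_eq_one h0)
      have h4 : (q + 1) / p < q + 1 := Nat.div_lt_self (by omega) hp.one_lt
      omega
  · rintro ⟨-, hoc, hnz⟩
    have hfull : α ^ ((q + 1) * (q - 1)) = 1 := by
      rw [← hsq, ← hcard]
      exact FiniteField.pow_card_sub_one_eq_one α hα0
    have hmd : orderOf (α ^ (q - 1)) ∣ q + 1 := by
      apply orderOf_dvd_of_pow_eq_one
      rw [← pow_mul, mul_comm, hfull]
    have hmpos : 0 < orderOf (α ^ (q - 1)) := Nat.pos_of_dvd_of_pos hmd (by omega)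
    have hlt : (q + 1) / p < orderOf (α ^ (q - 1)) := by
      by_contra hle
      push Not at hle
      apply hnz (e - 1 - orderOf (α ^ (q - 1))) (by omega)
      rw [hco _ (by omega)]
      have : e - 1 - (e - 1 - orderOf (α ^ (q - 1))) = orderOf (α ^ (q - 1)) := by omega
      rw [this, pow_orderOf_eq_one]
    rcases aux_nat q p _ hp hpdvd hpmin hmd hlt with hm | ⟨h2, hm⟩
    · apply Nat.dvd_antisymm (orderOf_dvd_of_pow_eq_one hfull)
      have h1 : q + 1 ∣ orderOf α := by
        rw [← hm]
        exact orderOf_pow_dvd _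
      obtain ⟨j, hj⟩ := h1
      rw [hj]
      apply Nat.mul_dvd_mul_left
      rw [← hoc]
      apply orderOf_dvd_of_pow_eq_one
      rw [← pow_mul, ← hj, pow_orderOf_eq_one]
    · exfalso
      have h3 := orderOf_dvd_iff_pow_eq_one.mp hm
      rw [← pow_mul] at h3
      have h4 : (α ^ (q + 1)) ^ ((q - 1) / 2) = 1 := by
        rw [← pow_mul, ← h3]
        congr 1
        obtain ⟨j, hj⟩ := h2
        have e1 : (q + 1) / 2 = j := by omega
        have e2 : q - 1 = 2 * (j - 1) := by omega
        have e3 : (q - 1) / 2 = j - 1 := by omega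
        rw [e1, e3, hj, e2]
        ring
      have h5 := orderOf_dvd_of_pow_eq_one h4
      rw [hoc] at h5
      have := Nat.le_of_dvd (by omega) h5
      omega
end

section
/- Let F_q be a finite field with q odd, let α be a primitive element of F_q, and let i be an integer with 0 ≤ i < q - 1. Then the polynomial x² + α^i·x + α is reducible over F_q if and only if there exists an integer k with 0 ≤ k < ⌊(q-1)/4⌋ such that α^i = α^{k+1} + α^{q-k-1} or α^i = -(α^{k+1} + α^{q-k-1}). -/
open Polynomial

theorem aux_irred {F : Type*} [Field F] (b c : F) :
    ¬ Irreducible (X ^ 2 + C b * X + C c : F[X]) ↔ ∃ r : F, r ^ 2 + b * r + c = 0 := by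
  have hd : (X ^ 2 + C b * X + C c : F[X]).natDegree = 2 := by compute_degree!
  rw [Polynomial.irreducible_iff_roots_eq_zero_of_degree_le_three (by omega) (by omega)]
  have h0 : (X ^ 2 + C b * X + C c : F[X]) ≠ 0 := by
    intro h; rw [h] at hd; simp at hd
  simp [Multiset.eq_zero_iff_forall_notMem, Polynomial.mem_roots h0]

theorem stmt_18 {F : Type*} [Field F] [Fintype F] (hodd : Odd (Fintype.card F))
    (α : F) (hα : IsPrimitiveElt α) (i : ℕ) (hi : i < Fintype.card F - 1) :
    ¬ Irreducible (X ^ 2 + C (α ^ i) * X + C α : F[X]) ↔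
      ∃ k : ℕ, k < (Fintype.card F - 1) / 4 ∧
        (α ^ i = α ^ (k + 1) + α ^ (Fintype.card F - k - 1) ∨
          α ^ i = -(α ^ (k + 1) + α ^ (Fintype.card F - k - 1))) := by
  have hc2 : ringChar F ≠ 2 := by
    intro h
    have := FiniteField.even_card_of_char_two h
    rw [Nat.odd_iff] at hodd
    omega
  have hm1 : (-1 : F) ≠ 1 := Ring.neg_one_ne_one_of_char_ne_two hc2
  have ha0 : α ≠ 0 := by
    rintro rfl
    obtain ⟨n, hn⟩ := hα (-1) (by simp)
    rcases Nat.eq_zero_or_pos n with rfl | hp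
    · exact hm1 (by simpa using hn)
    · rw [zero_pow hp.ne'] at hn
      simp at hn
  have hh : α ^ (Fintype.card F / 2) = -1 := by
    rcases FiniteField.pow_dichotomy hc2 ha0 with h | h
    · exfalso
      obtain ⟨x, hx⟩ := FiniteField.exists_nonsquare hc2
      have hx0 : x ≠ 0 := by rintro rfl; exact hx (by simp)
      apply hx
      rw [FiniteField.isSquare_iff hc2 hx0]
      obtain ⟨n, rfl⟩ := hα x hx0
      rw [← pow_mul, mul_comm, pow_mul, h, one_pow]
    · exact h
  obtain ⟨h, hq⟩ := hodd
  rw [hq] at hi ⊢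
  rw [hq, show (2 * h + 1) / 2 = h by omega] at hh
  have hn : α ^ (2 * h) = 1 := by rw [mul_comm, pow_mul, hh]; ring
  have hpos : 0 < h := by omega
  have hk4 : (2 * h + 1 - 1) / 4 = h / 2 := by omega
  rw [hk4, aux_irred]
  have hai : α ^ i ≠ 0 := pow_ne_zero _ ha0
  have key : ∀ k, k < h → α ^ (k + 1) * α ^ (2 * h + 1 - k - 1) = α := by
    intro k hk
    rw [← pow_add, show k + 1 + (2 * h + 1 - k - 1) = 2 * h + 1 by omega, pow_succ, hn, one_mul]
  constructor
  · rintro ⟨r, hr⟩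
    have hr0 : r ≠ 0 := by
      rintro rfl
      apply ha0
      simpa using hr
    obtain ⟨m, hm⟩ := hα r hr0
    -- reduce the exponent
    obtain ⟨a, e, ha1, hah, he, hra⟩ : ∃ (a : ℕ) (e : F), 1 ≤ a ∧ a ≤ h ∧ (e = 1 ∨ e = -1) ∧
        r = e * α ^ a := by
      have hdm := Nat.div_add_mod m h
      have hsgn : ∀ t : ℕ, (-1 : F) ^ t = 1 ∨ (-1 : F) ^ t = -1 := neg_one_pow_eq_or F
      rcases Nat.eq_zero_or_pos (m % h) with h0 | h0
      · refine ⟨h, -(-1) ^ (m / h), hpos, le_rfl, ?_, ?_⟩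
        · rcases hsgn (m / h) with h | h <;> simp [h]
        · rw [hh, hm]
          conv_lhs => rw [← hdm, h0, add_zero, pow_mul, hh]
          ring
      · refine ⟨m % h, (-1) ^ (m / h), h0, (Nat.mod_lt _ hpos).le, hsgn _, ?_⟩
        rw [hm]
        conv_lhs => rw [← hdm, pow_add, pow_mul, hh]
    have hee : e * e = 1 := by rcases he with rfl | rfl <;> ring
    have hp0 : α ^ a ≠ 0 := pow_ne_zero _ ha0
    -- the main identity
    obtain ⟨k, rfl⟩ : ∃ k, a = k + 1 := ⟨a - 1, by omega⟩
    have hkey := key k (by omega)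
    have main : α ^ i = -e * (α ^ (k + 1) + α ^ (2 * h + 1 - k - 1)) := by
      apply mul_right_cancel₀ hr0
      have h1 : -e * (α ^ (k + 1) + α ^ (2 * h + 1 - k - 1)) * r = -(r ^ 2) - α := by
        rw [hra]
        linear_combination (-(α ^ (k + 1) * α ^ (2 * h + 1 - k - 1))) * hee - hkey
      rw [h1]
      linear_combination hr
    have fin : ∀ j, j < h / 2 → ∀ f : F, (f = 1 ∨ f = -1) →
        α ^ i = f * (α ^ (j + 1) + α ^ (2 * h + 1 - j - 1)) →
        ∃ k : ℕ, k < h / 2 ∧ (α ^ i = α ^ (k + 1) + α ^ (2 * h + 1 - k - 1) ∨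
          α ^ i = -(α ^ (k + 1) + α ^ (2 * h + 1 - k - 1))) := by
      rintro j hj f (rfl | rfl) hf
      · exact ⟨j, hj, Or.inl (by rw [hf, one_mul])⟩
      · exact ⟨j, hj, Or.inr (by rw [hf, neg_one_mul])⟩
    have e1 : α ^ (2 * h + 1 - k - 1) = -α ^ (h - k) := by
      rw [show 2 * h + 1 - k - 1 = h + (h - k) by omega, pow_add, hh]; ring
    by_cases c1 : k < h / 2
    · exact fin k c1 (-e) (by rcases he with rfl | rfl <;> simp) main
    · by_cases c2 : h = 2 * k + 1
      · exfalso
        apply hai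
        rw [main, e1, show h - k = k + 1 by omega]
        ring
      · refine fin (h - k - 1) (by omega) e he ?_
        rw [main, e1, show h - k - 1 + 1 = h - k by omega,
          show 2 * h + 1 - (h - k - 1) - 1 = h + (k + 1) by omega, pow_add α h, hh]
        ring
  · rintro ⟨k, hk, h1 | h1⟩
    · refine ⟨-α ^ (k + 1), ?_⟩
      rw [h1]
      linear_combination -key k (by omega)
    · refine ⟨α ^ (k + 1), ?_⟩
      rw [h1]
      linear_combination -key k (by omega)
end

section
/- Let F_q be a finite field and let f = x² + b·x + c ∈ F_q[x] be irreducible. Then qord(f) divides q + 1. -/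
open Polynomial

theorem stmt_19 {F : Type*} [Field F] [Fintype F] (b c : F)
    (hirr : Irreducible (X ^ 2 + C b * X + C c : F[X])) :
    qord (X ^ 2 + C b * X + C c : F[X]) ∣ Fintype.card F + 1 := by
  have hdeg : (X ^ 2 + C b * X + C c : F[X]).natDegree = 2 := by
    compute_degree!
  have hnr : ∀ a : F, ¬ (X ^ 2 + C b * X + C c : F[X]) ∣ X - C a := by
    intro a h
    have := natDegree_le_of_dvd h (X_sub_C_ne_zero a)
    rw [hdeg, natDegree_X_sub_C] at this
    omega
  have hc : c ≠ 0 := by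
    rintro rfl
    have h1 : (X ^ 2 + C b * X + C 0 : F[X]) = X * (X + C b) := by
      simp; ring
    rw [h1] at hirr
    rcases hirr.isUnit_or_isUnit rfl with h | h
    · exact not_isUnit_X h
    · have := natDegree_eq_zero_of_isUnit h
      rw [natDegree_X_add_C] at this
      omega
  have hprod : (∏ a : F, (X - C a) : F[X]) = X ^ Fintype.card F - X := by
    have h := FiniteField.roots_X_pow_card_sub_X F
    have hm : (X ^ Fintype.card F - X : F[X]).Monic :=
      monic_X_pow_sub (by rw [degree_X]; exact_mod_cast Fintype.one_lt_card)
    have h2 := prod_multiset_X_sub_C_of_monic_of_roots_card_eq hm (by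
      rw [h, FiniteField.X_pow_card_sub_X_natDegree_eq F Fintype.one_lt_card]; simp)
    rw [h] at h2
    exact h2
  have hfx : ¬ (X ^ 2 + C b * X + C c : F[X]) ∣ X ^ Fintype.card F - X := by
    rw [← hprod, hirr.prime.dvd_finset_prod_iff]
    rintro ⟨a, _, h⟩
    exact hnr a h
  have key : (X ^ 2 + C b * X + C c : F[X]) ∣ X ^ (Fintype.card F + 1) - C c := by
    have h1 : (X ^ 2 + C b * X + C c : F[X]) ∣
        (X ^ Fintype.card F - X) * (X ^ Fintype.card F + X + C b) := by
      have h2 := FiniteField.expand_card (X ^ 2 + C b * X + C c : F[X])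
      simp only [map_add, map_mul, map_pow, expand_X, expand_C] at h2
      have h3 : (X ^ Fintype.card F - X) * (X ^ Fintype.card F + X + C b)
        = (X ^ 2 + C b * X + C c : F[X]) ^ Fintype.card F - (X ^ 2 + C b * X + C c : F[X]) := by
        rw [← h2]; ring
      rw [h3]
      exact dvd_sub (dvd_pow_self _ Fintype.card_ne_zero) dvd_rfl
    have h4 := (hirr.prime.dvd_or_dvd h1).resolve_left hfx
    have h5 : (X ^ (Fintype.card F + 1) - C c : F[X]) =
        X * (X ^ Fintype.card F + X + C b) - (X ^ 2 + C b * X + C c) := by ring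
    rw [h5]
    exact dvd_sub (h4.mul_left _) dvd_rfl
  have hmem := Nat.sInf_mem (s := {ρ : ℕ | 0 < ρ ∧ ∃ a : F, a ≠ 0 ∧
    (X ^ 2 + C b * X + C c : F[X]) ∣ (X ^ ρ - C a)}) ⟨Fintype.card F + 1, by omega, c, hc, key⟩
  change qord (X ^ 2 + C b * X + C c : F[X]) ∈ _ at hmem
  have hmin : ∀ m, m < qord (X ^ 2 + C b * X + C c : F[X]) → ¬ (0 < m ∧ ∃ a : F, a ≠ 0 ∧
    (X ^ 2 + C b * X + C c : F[X]) ∣ (X ^ m - C a)) := fun m hm => Nat.notMem_of_lt_sInf hm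
  generalize qord (X ^ 2 + C b * X + C c : F[X]) = ρ at *
  generalize (X ^ 2 + C b * X + C c : F[X]) = f at *
  generalize Fintype.card F + 1 = n at *
  obtain ⟨hρ, a, ha, hdvd⟩ := hmem
  by_contra hnd
  have hr : 0 < n % ρ := Nat.pos_of_ne_zero fun h => hnd (Nat.dvd_of_mod_eq_zero h)
  refine hmin _ (Nat.mod_lt n hρ) ⟨hr, c / a ^ (n / ρ), div_ne_zero hc (pow_ne_zero _ ha), ?_⟩
  have h6 : f ∣ X ^ (ρ * (n / ρ)) - C a ^ (n / ρ) := by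
    rw [pow_mul]
    exact hdvd.trans (sub_dvd_pow_sub_pow _ _ _)
  have h7 : C (a ^ (n / ρ))⁻¹ * C a ^ (n / ρ) = (1 : F[X]) := by
    rw [← C_pow, ← C_mul, inv_mul_cancel₀ (pow_ne_zero _ ha), C_1]
  have h8 : (X ^ n : F[X]) = X ^ (n % ρ) * X ^ (ρ * (n / ρ)) := by
    rw [← pow_add, Nat.mod_add_div]
  rw [h8] at key
  have h9 : (X ^ (n % ρ) - C (c / a ^ (n / ρ)) : F[X]) =
      C (a ^ (n / ρ))⁻¹ * ((X ^ (n % ρ) * X ^ (ρ * (n / ρ)) - C c)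
        - X ^ (n % ρ) * (X ^ (ρ * (n / ρ)) - C a ^ (n / ρ))) := by
    rw [div_eq_mul_inv, C_mul]
    linear_combination (-(X ^ (n % ρ)) : F[X]) * h7
  rw [h9]
  exact (dvd_sub key (h6.mul_left _)).mul_left _
end
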